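/- Let δ ≥ 0, b ∈ ℝ, φ(ρ) = ρ + δ ln ρ + b, and L₀g = g'' + (1 + 1/(4ρ²) + 8δ ρ^{-1} cos²φ) g. Then for every k ≥ 1 and every integer i ≥ 0 there exist real constants a_{i'}, b_{i'}, c_{i'}, d_{i'} (i' ≤ i) such that for all ρ > 0: L₀( ρ^{-k} ln^i ρ · cos φ ) = ( 2k sin φ + 4δ cos φ + 2δ cos 3φ ) ρ^{-(k+1)} ln^i ρ − 2i sin φ · ρ^{-(k+1)} ln^{i−1} ρ + Σ_{i' ≤ i} ( a_{i'} cos φ + b_{i'} sin φ ) ρ^{-(k+2)} ln^{i'} ρ, and L₀( ρ^{-k} ln^i ρ · sin φ ) = ( −2k cos φ + 2δ sin 3φ ) ρ^{-(k+1)} ln^i ρ + 2i cos φ · ρ^{-(k+1)} ln^{i−1} ρ + Σ_{i' ≤ i} ( c_{i'} cos φ + d_{i'} sin φ ) ρ^{-(k+2)} ln^{i'} ρ. -/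

import Mathlib

open Real

/-- The linearization `L₀ = L'(a cos φ)` of the ODE operator at `a cos φ`:
`L₀g = g'' + (1 + 1/(4ρ²) + 8δρ^{-1}cos²φ)g`, with `φ(ρ) = ρ + δ log ρ + b`. -/
noncomputable def L0 (δ b : ℝ) (g : ℝ → ℝ) (ρ : ℝ) : ℝ :=
  deriv (deriv g) ρ
    + (1 + 1 / (4 * ρ ^ 2) + 8 * δ / ρ * (Real.cos (ρ + δ * Real.log ρ + b)) ^ 2) * g ρ

/-- The derivative of `log^i r / r^k` on the positive half-line. -/
theorem hasDerivAt_log_pow_div_pow (i k : ℕ) {r : ℝ} (hr : 0 < r) :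
    HasDerivAt (fun r => Real.log r ^ i / r ^ k)
      (i * (Real.log r ^ (i - 1) / r ^ (k + 1)) - k * (Real.log r ^ i / r ^ (k + 1))) r := by
  have h := ((Real.hasDerivAt_log hr.ne').fun_pow i).fun_div (hasDerivAt_pow k r)
    (pow_ne_zero k hr.ne')
  refine h.congr_deriv ?_
  have hr' := hr.ne'
  rcases k with _ | k
  · simp
    field_simp
  · simp only [Nat.add_sub_cancel]
    field_simp
    ring

/-- The second derivative of `T(φ) log^i r / r^k`, where `φ = r + δ log r + b` and `T'' = -T`. -/
theorem deriv_deriv_oscillation_mul_log_pow_div_pow (δ b : ℝ) (k i : ℕ) {T T' : ℝ → ℝ}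
    (hT : ∀ x, HasDerivAt T (T' x) x) (hT' : ∀ x, HasDerivAt T' (-T x) x)
    {r : ℝ} (hr : 0 < r) :
    deriv (deriv fun r => T (r + δ * Real.log r + b) * Real.log r ^ i / r ^ k) r =
      -T (r + δ * Real.log r + b) * (1 + δ / r) ^ 2 * (Real.log r ^ i / r ^ k)
        - T' (r + δ * Real.log r + b) * (δ / r ^ 2) * (Real.log r ^ i / r ^ k)
        + 2 * T' (r + δ * Real.log r + b) * (1 + δ / r) *
          (i * (Real.log r ^ (i - 1) / r ^ (k + 1)) - k * (Real.log r ^ i / r ^ (k + 1)))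
        + T (r + δ * Real.log r + b) *
          (i * (((i - 1 : ℕ) : ℝ) * Real.log r ^ (i - 1 - 1)) - (2 * k + 1) * i *
            Real.log r ^ (i - 1) + k * (k + 1) * Real.log r ^ i) / r ^ (k + 2) := by
  have hφ : ∀ s : ℝ, 0 < s → HasDerivAt (fun s => s + δ * Real.log s + b) (1 + δ * s⁻¹) s :=
    fun s hs => ((hasDerivAt_id s).add ((Real.hasDerivAt_log hs.ne').const_mul δ)).add_const b
  have first : ∀ s : ℝ, 0 < s →
      deriv (fun r => T (r + δ * Real.log r + b) * Real.log r ^ i / r ^ k) s =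
        T' (s + δ * Real.log s + b) * (1 + δ * s⁻¹) * (Real.log s ^ i / s ^ k) +
          T (s + δ * Real.log s + b) *
          (i * (Real.log s ^ (i - 1) / s ^ (k + 1)) - k * (Real.log s ^ i / s ^ (k + 1))) := by
    intro s hs
    simp only [mul_div_assoc]
    exact (((hT _).comp s (hφ s hs)).mul (hasDerivAt_log_pow_div_pow i k hs)).deriv
  have hev : deriv (fun r => T (r + δ * Real.log r + b) * Real.log r ^ i / r ^ k) =ᶠ[nhds r] _ :=
    Filter.eventually_of_mem (Ioi_mem_nhds hr) first
  rw [hev.deriv_eq]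
  have second := ((((hT' _).comp r (hφ r hr)).mul
      (((hasDerivAt_inv hr.ne').const_mul δ).const_add 1)).mul
        (hasDerivAt_log_pow_div_pow i k hr)).add
    (((hT _).comp r (hφ r hr)).mul
      (((hasDerivAt_log_pow_div_pow (i - 1) (k + 1) hr).const_mul (i : ℝ)).sub
        ((hasDerivAt_log_pow_div_pow i (k + 1) hr).const_mul (k : ℝ))))
  refine (second.deriv).trans ?_
  simp only [Function.comp_apply, Pi.mul_apply, Pi.sub_apply]
  have hr' := hr.ne'
  push_cast
  field_simp
  ring

/-- The coefficient of `T(φ) log^j ρ / ρ^(k+2)` in `L₀(T(φ) log^i ρ / ρ^k)`. -/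
noncomputable def errorCoeff (δ : ℝ) (k i j : ℕ) : ℝ :=
  (if j = i then 1 / 4 - δ ^ 2 + k * (k + 1) else 0)
    + (if j = i - 1 then -((2 * k + 1 : ℝ) * i) else 0)
    + (if j = i - 1 - 1 then (i : ℝ) * ((i - 1 : ℕ) : ℝ) else 0)

/-- The coefficient of `T'(φ) log^j ρ / ρ^(k+2)` in `L₀(T(φ) log^i ρ / ρ^k)`. -/
noncomputable def errorCoeffDeriv (δ : ℝ) (k i j : ℕ) : ℝ :=
  (if j = i then -(δ * (2 * k + 1)) else 0) + (if j = i - 1 then 2 * δ * i else 0)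

theorem sum_errorCoeff (δ : ℝ) (k i : ℕ) (x : ℝ) :
    ∑ j ∈ Finset.range (i + 1), errorCoeff δ k i j * x ^ j =
      (1 / 4 - δ ^ 2 + k * (k + 1)) * x ^ i - (2 * k + 1) * i * x ^ (i - 1)
        + i * ((i - 1 : ℕ) : ℝ) * x ^ (i - 1 - 1) := by
  have h₁ : i - 1 < i + 1 := by omega
  have h₂ : i - 1 - 1 < i + 1 := by omega
  simp only [errorCoeff, add_mul, ite_mul, zero_mul, Finset.sum_add_distrib,
    Finset.sum_ite_eq', Finset.mem_range, h₁, h₂, Nat.lt_succ_self, if_true]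
  ring

theorem sum_errorCoeffDeriv (δ : ℝ) (k i : ℕ) (x : ℝ) :
    ∑ j ∈ Finset.range (i + 1), errorCoeffDeriv δ k i j * x ^ j =
      -(δ * (2 * k + 1)) * x ^ i + 2 * δ * i * x ^ (i - 1) := by
  have h₁ : i - 1 < i + 1 := by omega
  simp only [errorCoeffDeriv, add_mul, ite_mul, zero_mul, Finset.sum_add_distrib,
    Finset.sum_ite_eq', Finset.mem_range, h₁, Nat.lt_succ_self, if_true]

/-- `L₀` applied to `T(φ) log^i ρ / ρ^k` with `T'' = -T`, expanded in powers of `ρ`. -/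
theorem L0_oscillation_mul_log_pow_div_pow (δ b : ℝ) (k i : ℕ) {T T' : ℝ → ℝ}
    (hT : ∀ x, HasDerivAt T (T' x) x) (hT' : ∀ x, HasDerivAt T' (-T x) x)
    {ρ : ℝ} (hρ : 0 < ρ) :
    L0 δ b (fun r => T (r + δ * Real.log r + b) * Real.log r ^ i / r ^ k) ρ =
      (-(2 * k) * T' (ρ + δ * Real.log ρ + b)
          + δ * (8 * Real.cos (ρ + δ * Real.log ρ + b) ^ 2 - 2) * T (ρ + δ * Real.log ρ + b)) *
          Real.log ρ ^ i / ρ ^ (k + 1)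
        + 2 * i * T' (ρ + δ * Real.log ρ + b) * Real.log ρ ^ (i - 1) / ρ ^ (k + 1)
        + ∑ j ∈ Finset.range (i + 1),
            (errorCoeff δ k i j * T (ρ + δ * Real.log ρ + b)
              + errorCoeffDeriv δ k i j * T' (ρ + δ * Real.log ρ + b)) *
              Real.log ρ ^ j / ρ ^ (k + 2) := by
  have hsum : ∀ t t' : ℝ,
      ∑ j ∈ Finset.range (i + 1), (errorCoeff δ k i j * t + errorCoeffDeriv δ k i j * t') *
          Real.log ρ ^ j / ρ ^ (k + 2) =
        (t * ∑ j ∈ Finset.range (i + 1), errorCoeff δ k i j * Real.log ρ ^ j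
          + t' * ∑ j ∈ Finset.range (i + 1), errorCoeffDeriv δ k i j * Real.log ρ ^ j) /
          ρ ^ (k + 2) := by
    intro t t'
    rw [Finset.mul_sum, Finset.mul_sum, ← Finset.sum_add_distrib, Finset.sum_div]
    exact Finset.sum_congr rfl fun j _ => by ring
  rw [hsum, sum_errorCoeff, sum_errorCoeffDeriv, L0,
    deriv_deriv_oscillation_mul_log_pow_div_pow δ b k i hT hT' hρ]
  have hρ' := hρ.ne'
  field_simp
  ring

/-- Action of `L₀` on the resonant terms `ρ^{-k} ln^i ρ cos φ` and
`ρ^{-k} ln^i ρ sin φ`: these produce resonant terms at order `ρ^{-(k+1)}` with the same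
power of the logarithm, resonant terms with one lower power of the logarithm, and
`ρ^{-(k+2)}`-errors. -/
theorem L0_on_resonant_terms (δ b : ℝ) (hδ : 0 ≤ δ) (k i : ℕ) (hk : 1 ≤ k) :
    ∃ A B C D : ℕ → ℝ,
      (∀ ρ : ℝ, 0 < ρ →
        L0 δ b (fun r => Real.cos (r + δ * Real.log r + b) * (Real.log r) ^ i / r ^ k) ρ =
          (2 * k * Real.sin (ρ + δ * Real.log ρ + b)
              + 4 * δ * Real.cos (ρ + δ * Real.log ρ + b)
              + 2 * δ * Real.cos (3 * (ρ + δ * Real.log ρ + b))) *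
              (Real.log ρ) ^ i / ρ ^ (k + 1)
            - 2 * i * Real.sin (ρ + δ * Real.log ρ + b) * (Real.log ρ) ^ (i - 1) / ρ ^ (k + 1)
            + ∑ i' ∈ Finset.range (i + 1),
                (A i' * Real.cos (ρ + δ * Real.log ρ + b)
                  + B i' * Real.sin (ρ + δ * Real.log ρ + b)) *
                  (Real.log ρ) ^ i' / ρ ^ (k + 2)) ∧
      (∀ ρ : ℝ, 0 < ρ →
        L0 δ b (fun r => Real.sin (r + δ * Real.log r + b) * (Real.log r) ^ i / r ^ k) ρ =
          (-(2 * k) * Real.cos (ρ + δ * Real.log ρ + b)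
              + 2 * δ * Real.sin (3 * (ρ + δ * Real.log ρ + b))) *
              (Real.log ρ) ^ i / ρ ^ (k + 1)
            + 2 * i * Real.cos (ρ + δ * Real.log ρ + b) * (Real.log ρ) ^ (i - 1) / ρ ^ (k + 1)
            + ∑ i' ∈ Finset.range (i + 1),
                (C i' * Real.cos (ρ + δ * Real.log ρ + b)
                  + D i' * Real.sin (ρ + δ * Real.log ρ + b)) *
                  (Real.log ρ) ^ i' / ρ ^ (k + 2)) := by
  refine ⟨errorCoeff δ k i, fun j => -errorCoeffDeriv δ k i j, errorCoeffDeriv δ k i,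
    errorCoeff δ k i, fun ρ hρ => ?_, fun ρ hρ => ?_⟩
  · rw [L0_oscillation_mul_log_pow_div_pow (T' := fun x => -Real.sin x) δ b k i
      Real.hasDerivAt_cos (fun x => (Real.hasDerivAt_sin x).neg) hρ, Real.cos_three_mul]
    simp only [mul_neg, neg_mul]
    ring
  · rw [L0_oscillation_mul_log_pow_div_pow δ b k i Real.hasDerivAt_sin Real.hasDerivAt_cos hρ,
      Real.sin_three_mul, Real.cos_sq']
    congr 1
    · ring
    · exact Finset.sum_congr rfl fun j _ => by ring
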